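/- Let χ* be the unique positive real solution of φ(χ) = 2χ(1 − Φ(χ)). Then b* := μ + 2χ*√(λ₁) v minimizes the constrained (hierarchical) cost b ↦ J(μ, b) over ℝⁿ, and the minimal value is J(μ, b*) = trace(R) − 2χ* φ(χ*) λ₁. -/

import Mathlib

open MeasureTheory Matrix

/-- The standard normal probability density function. -/
noncomputable def stdGaussianPDF (x : ℝ) : ℝ :=
  Real.exp (-x ^ 2 / 2) / Real.sqrt (2 * Real.pi)

/-- The standard normal cumulative distribution function. -/
noncomputable def stdGaussianCDF (x : ℝ) : ℝ :=
  ∫ t in Set.Iic x, stdGaussianPDF t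

section OneDim
open ProbabilityTheory Filter Topology

lemma aux_pdf_eq : stdGaussianPDF = gaussianPDFReal 0 1 := by
  funext x
  simp only [stdGaussianPDF, gaussianPDFReal]
  simp [div_eq_inv_mul]

lemma aux_pdf_pos (x : ℝ) : 0 < stdGaussianPDF x := by
  unfold stdGaussianPDF; positivity

lemma aux_pdf_cont : Continuous stdGaussianPDF := by
  unfold stdGaussianPDF; fun_prop

lemma aux_pdf_int : Integrable stdGaussianPDF := by
  rw [aux_pdf_eq]; exact integrable_gaussianPDFReal 0 1

lemma aux_pdf_deriv (x : ℝ) : HasDerivAt stdGaussianPDF (-x * stdGaussianPDF x) x := by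
  unfold stdGaussianPDF
  have h1 : HasDerivAt (fun x : ℝ => -x ^ 2 / 2) (-x) x := by
    have := ((hasDerivAt_pow 2 x).neg).div_const 2
    exact this.congr_deriv (by simp; ring)
  have := (h1.exp).div_const (Real.sqrt (2 * Real.pi))
  exact this.congr_deriv (by ring)

lemma aux_cdf_deriv (x : ℝ) : HasDerivAt stdGaussianCDF (stdGaussianPDF x) x := by
  have h : stdGaussianCDF = fun u => stdGaussianCDF 0 + ∫ t in (0:ℝ)..u, stdGaussianPDF t := by
    funext u
    rw [← intervalIntegral.integral_Iic_sub_Iic aux_pdf_int.integrableOn aux_pdf_int.integrableOn]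
    simp [stdGaussianCDF]
  rw [h]
  exact (intervalIntegral.integral_hasDerivAt_right (aux_pdf_cont.intervalIntegrable _ _)
    (aux_pdf_cont.stronglyMeasurableAtFilter _ _) aux_pdf_cont.continuousAt).const_add _

lemma aux_cdf_compl (x : ℝ) : 1 - stdGaussianCDF x = ∫ t in Set.Ioi x, stdGaussianPDF t := by
  have h := intervalIntegral.integral_Iic_add_Ioi (b := x) (μ := volume)
    aux_pdf_int.integrableOn aux_pdf_int.integrableOn
  have h1 : ∫ t, stdGaussianPDF t = 1 := by
    rw [aux_pdf_eq]; exact integral_gaussianPDFReal_eq_one 0 one_ne_zero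
  rw [h1] at h
  unfold stdGaussianCDF
  linarith

lemma aux_cdf_le (x : ℝ) : 0 ≤ 1 - stdGaussianCDF x := by
  rw [aux_cdf_compl]
  exact integral_nonneg (fun t => (aux_pdf_pos t).le)

noncomputable def auxG (t : ℝ) : ℝ := stdGaussianPDF t - t * (1 - stdGaussianCDF t)

lemma auxG_deriv (x : ℝ) : HasDerivAt auxG (-(1 - stdGaussianCDF x)) x := by
  have := (aux_pdf_deriv x).sub ((hasDerivAt_id x).mul ((aux_cdf_deriv x).const_sub 1))
  exact this.congr_deriv (by simp only [id]; ring)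

lemma auxG_anti : Antitone auxG := by
  apply antitone_of_deriv_nonpos (fun x => (auxG_deriv x).differentiableAt)
  intro x
  rw [(auxG_deriv x).deriv]
  linarith [aux_cdf_le x]

lemma aux_tpdf_bound (t : ℝ) (ht : 0 < t) : t * stdGaussianPDF t ≤ 2 / t := by
  unfold stdGaussianPDF
  have hs : 1 ≤ Real.sqrt (2 * Real.pi) := by
    rw [Real.one_le_sqrt]; nlinarith [Real.pi_gt_three]
  have he : Real.exp (-t ^ 2 / 2) ≤ 2 / t ^ 2 := by
    rw [neg_div, Real.exp_neg, inv_eq_one_div, div_le_div_iff₀ (Real.exp_pos _) (by positivity)]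
    have := Real.add_one_le_exp (t ^ 2 / 2)
    linarith
  calc t * (Real.exp (-t ^ 2 / 2) / Real.sqrt (2 * Real.pi))
      ≤ t * Real.exp (-t ^ 2 / 2) := by
        apply mul_le_mul_of_nonneg_left _ ht.le
        exact div_le_self (Real.exp_pos _).le hs
    _ ≤ t * (2 / t ^ 2) := mul_le_mul_of_nonneg_left he ht.le
    _ = 2 / t := by field_simp

lemma aux_pdf_tendsto : Tendsto stdGaussianPDF atTop (𝓝 0) := by
  have h2 : Tendsto (fun t : ℝ => 2 / t / t) atTop (𝓝 0) := by
    have h : Tendsto (fun t : ℝ => 2 / t) atTop (𝓝 0) := tendsto_const_nhds.div_atTop tendsto_id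
    exact h.div_atTop tendsto_id
  refine squeeze_zero' (Eventually.of_forall fun t => (aux_pdf_pos t).le) ?_ h2
  filter_upwards [eventually_gt_atTop 0] with t ht
  rw [le_div_iff₀ ht, mul_comm]
  exact aux_tpdf_bound t ht

lemma aux_xpdf_int : Integrable (fun x => x * stdGaussianPDF x) := by
  have := (integrable_mul_exp_neg_mul_sq (b := 1 / 2) (by norm_num)).div_const
    (Real.sqrt (2 * Real.pi))
  refine this.congr (Eventually.of_forall fun x => ?_)
  simp only [stdGaussianPDF]
  rw [mul_div_assoc]
  congr 3
  ring

lemma aux_expect (t : ℝ) : ∫ z, max 0 (z - t) ∂(gaussianReal 0 1) = auxG t := by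
  rw [integral_gaussianReal_eq_integral_smul one_ne_zero, ← aux_pdf_eq]
  have h1 : (fun x => stdGaussianPDF x • max 0 (x - t)) =
      (Set.Ioi t).indicator (fun x => x * stdGaussianPDF x - t * stdGaussianPDF x) := by
    funext x
    by_cases hx : t < x
    · rw [Set.indicator_of_mem (by exact hx), max_eq_right (by linarith), smul_eq_mul]; ring
    · rw [Set.indicator_of_notMem (by exact hx), max_eq_left (by linarith), smul_zero]
  rw [h1, integral_indicator measurableSet_Ioi,
    integral_sub aux_xpdf_int.integrableOn (aux_pdf_int.const_mul t).integrableOn,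
    integral_const_mul, ← aux_cdf_compl]
  have h2 := integral_Ioi_of_hasDerivAt_of_tendsto (f := fun x => - stdGaussianPDF x)
    (f' := fun x => x * stdGaussianPDF x) (a := t) (m := 0)
    aux_pdf_cont.neg.continuousWithinAt
    (fun x _ => (aux_pdf_deriv x).neg.congr_deriv (by ring))
    aux_xpdf_int.integrableOn (by simpa using aux_pdf_tendsto.neg)
  rw [h2, auxG]; ring

lemma auxG_nonneg (t : ℝ) : 0 ≤ auxG t := by
  rw [← aux_expect]
  exact integral_nonneg (fun z => le_max_left _ _)

lemma auxG_max (χs : ℝ) (hχpos : 0 < χs)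
    (hχeq : stdGaussianPDF χs = 2 * χs * (1 - stdGaussianCDF χs))
    (hχuniq : ∀ χ : ℝ, 0 < χ →
      stdGaussianPDF χ = 2 * χ * (1 - stdGaussianCDF χ) → χ = χs) (t : ℝ) (ht : 0 < t) :
    t * auxG t ≤ χs * auxG χs := by
  by_contra! hcon
  have hd : ∀ x, HasDerivAt (fun x => x * auxG x)
      (stdGaussianPDF x - 2 * x * (1 - stdGaussianCDF x)) x := by
    intro x
    exact ((hasDerivAt_id x).mul (auxG_deriv x)).congr_deriv (by simp only [auxG, id]; ring)
  have hpos : 0 < χs * auxG χs := by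
    have : auxG χs = stdGaussianPDF χs / 2 := by unfold auxG; linarith
    rw [this]; have := aux_pdf_pos χs; positivity
  set H := χs * auxG χs with hH
  obtain ⟨M, hMt, hM⟩ : ∃ M, t < M ∧ 2 / M < H := by
    refine ⟨max t (2 / H) + 1, by linarith [le_max_left t (2 / H)], ?_⟩
    have h0 : 2 / H < max t (2 / H) + 1 := by linarith [le_max_right t (2 / H)]
    rw [div_lt_iff₀ hpos] at h0
    rw [div_lt_iff₀ (by linarith [le_max_left t (2 / H)])]
    linarith
  have hM0 : 0 < M := ht.trans hMt
  obtain ⟨p, hp, hpmax⟩ := isCompact_Icc.exists_isMaxOn (s := Set.Icc 0 M) ⟨t, ht.le, hMt.le⟩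
    (f := fun x => x * auxG x) (fun x _ => (hd x).continuousAt.continuousWithinAt)
  have h1 : t * auxG t ≤ p * auxG p := hpmax (a := t) ⟨ht.le, hMt.le⟩
  have hp0 : 0 < p := by
    rcases hp.1.eq_or_lt with h | h
    · rw [← h] at h1; linarith
    · exact h
  have hpM : p < M := by
    rcases hp.2.eq_or_lt with h | h
    · rw [h] at h1
      have h3 : auxG M ≤ stdGaussianPDF M := by
        unfold auxG; have := mul_nonneg hM0.le (aux_cdf_le M); linarith
      have h4 := mul_le_mul_of_nonneg_left h3 hM0.le
      have h5 := aux_tpdf_bound M hM0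
      linarith
    · exact h
  have hloc : IsLocalMax (fun x => x * auxG x) p := hpmax.isLocalMax (Icc_mem_nhds hp0 hpM)
  have h0 := hloc.hasDerivAt_eq_zero (hd p)
  have := hχuniq p hp0 (by linarith)
  rw [this] at h1
  linarith

end OneDim

section Dens
open ProbabilityTheory Filter Topology
open scoped MatrixOrder

lemma aux_std_density (n : ℕ) :
    stdGaussian (EuclideanSpace ℝ (Fin n)) = volume.withDensity (fun x =>
      ENNReal.ofReal ((2 * Real.pi) ^ (-(n : ℝ) / 2) * Real.exp (-(1 / 2) * ‖x‖ ^ 2))) := by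
  have hre : (0:ℝ) < ((1 / 2 : ℂ)).re := by norm_num
  have hI : Integrable (fun x : EuclideanSpace ℝ (Fin n) =>
      (2 * Real.pi) ^ (-(n : ℝ) / 2) * Real.exp (-(1 / 2) * ‖x‖ ^ 2)) := by
    have h := (GaussianFourier.integrable_cexp_neg_mul_sq_norm_add hre 0
      (0 : EuclideanSpace ℝ (Fin n))).norm
    refine (h.congr (Eventually.of_forall fun x => ?_)).const_mul _
    simp only [Complex.norm_exp]
    congr 1
    have : (-(1 / 2 : ℂ) * (‖x‖ : ℂ) ^ 2 + 0 * ((inner ℝ (0 : EuclideanSpace ℝ (Fin n)) x : ℝ) : ℂ))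
        = ((-(1 / 2) * ‖x‖ ^ 2 : ℝ) : ℂ) := by push_cast; ring
    rw [this, Complex.ofReal_re]
  have := isFiniteMeasure_withDensity_ofReal hI.2
  apply Measure.ext_of_charFun
  funext t
  rw [charFun_stdGaussian, charFun_apply,
    integral_withDensity_eq_integral_toReal_smul (by fun_prop) (by simp)]
  have hpt : ∀ x : EuclideanSpace ℝ (Fin n), (ENNReal.ofReal ((2 * Real.pi) ^ (-(n : ℝ) / 2) *
      Real.exp (-(1 / 2) * ‖x‖ ^ 2))).toReal • Complex.exp ((inner ℝ x t : ℝ) * Complex.I) =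
      (((2 * Real.pi) ^ (-(n : ℝ) / 2) : ℝ) : ℂ) * Complex.exp (-(1 / 2 : ℂ) * (‖x‖ : ℂ) ^ 2 +
        Complex.I * ((inner ℝ t x : ℝ) : ℂ)) := by
    intro x
    rw [ENNReal.toReal_ofReal (by positivity), Complex.real_smul, Complex.exp_add,
      real_inner_comm]
    push_cast
    ring_nf
  simp_rw [hpt]
  rw [integral_const_mul, GaussianFourier.integral_cexp_neg_mul_sq_norm_add hre]
  rw [finrank_euclideanSpace_fin]
  have h1 : ((Real.pi : ℂ) / (1 / 2)) ^ ((n : ℂ) / 2) =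
      (((2 * Real.pi) ^ ((n : ℝ) / 2) : ℝ) : ℂ) := by
    rw [Complex.ofReal_cpow (by positivity)]
    push_cast
    congr 1
    ring
  rw [h1, ← mul_assoc, ← Complex.ofReal_mul, ← Real.rpow_add (by positivity)]
  have h2 : -(n:ℝ) / 2 + (n:ℝ) / 2 = 0 := by ring
  rw [h2, Real.rpow_zero, Complex.ofReal_one, one_mul]
  congr 1
  rw [Complex.I_sq]
  ring

lemma aux_density (n : ℕ) (μv : EuclideanSpace ℝ (Fin n))
    (R : Matrix (Fin n) (Fin n) ℝ) (hR : R.PosDef) :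
    volume.withDensity (fun x : EuclideanSpace ℝ (Fin n) =>
      ENNReal.ofReal ((2 * Real.pi) ^ (-(n : ℝ) / 2) * R.det ^ (-(1 : ℝ) / 2) *
        Real.exp (-(1 / 2) *
          ((fun i => x i - μv i) ⬝ᵥ R⁻¹.mulVec (fun i => x i - μv i))))) =
      multivariateGaussian μv R := by
  rw [multivariateGaussian, aux_std_density]
  set S := CFC.sqrt R with hS
  have hSS : S * S = R := CFC.sqrt_mul_sqrt_self R hR.posSemidef.nonneg
  have hSsym : Sᵀ = S := by
    have := (CFC.sqrt_nonneg R).isSelfAdjoint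
    rw [← Matrix.conjTranspose_eq_transpose_of_trivial]
    exact this.star_eq
  have hdet2 : S.det ^ 2 = R.det := by rw [sq, ← Matrix.det_mul, hSS]
  have hdetpos := hR.det_pos
  have hdet : S.det ≠ 0 := by
    intro h; rw [h] at hdet2; simp at hdet2; linarith
  have habs : |S.det| = R.det ^ ((1:ℝ) / 2) := by
    rw [← hdet2, ← Real.sqrt_eq_rpow, Real.sqrt_sq_eq_abs]
  set T : EuclideanSpace ℝ (Fin n) → EuclideanSpace ℝ (Fin n) :=
    fun x ↦ μv + toEuclideanCLM (𝕜 := ℝ) S x with hT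
  have hTm : Measurable T := by fun_prop
  have hdl : LinearMap.det (toEuclideanCLM (n := Fin n) (𝕜 := ℝ) S :
      EuclideanSpace ℝ (Fin n) →ₗ[ℝ] EuclideanSpace ℝ (Fin n)) = S.det := by
    rw [coe_toEuclideanCLM_eq_toEuclideanLin]
    exact LinearMap.det_toLpLin _ _
  have hmap : Measure.map T volume = ENNReal.ofReal |S.det|⁻¹ • volume := by
    have h : T = (fun x => μv + x) ∘ (toEuclideanCLM (n := Fin n) (𝕜 := ℝ) S :
      EuclideanSpace ℝ (Fin n) →ₗ[ℝ] EuclideanSpace ℝ (Fin n)) := rfl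
    have hfm : Measurable (toEuclideanCLM (n := Fin n) (𝕜 := ℝ) S :
      EuclideanSpace ℝ (Fin n) →ₗ[ℝ] EuclideanSpace ℝ (Fin n)) :=
      (toEuclideanCLM (n := Fin n) (𝕜 := ℝ) S).continuous.measurable
    rw [h, ← Measure.map_map (measurable_const_add μv) hfm,
      Measure.map_linearMap_addHaar_eq_smul_addHaar _ (by rwa [hdl]), Measure.map_smul,
      map_add_left_eq_self, hdl, abs_inv]
  have hvol : (volume : Measure (EuclideanSpace ℝ (Fin n))) =
      ENNReal.ofReal |S.det| • Measure.map T volume := by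
    rw [hmap, smul_smul, ← ENNReal.ofReal_mul (abs_nonneg _), mul_inv_cancel₀ (by simpa using hdet)]
    simp
  have hquad : ∀ x : EuclideanSpace ℝ (Fin n),
      (fun i => T x i - μv i) ⬝ᵥ R⁻¹.mulVec (fun i => T x i - μv i) = ‖x‖ ^ 2 := by
    intro x
    have h1 : (fun i => T x i - μv i) = S *ᵥ x.ofLp := by
      funext i
      simp [hT]
    have hu : IsUnit S.det := isUnit_iff_ne_zero.mpr hdet
    rw [h1, ← hSS, Matrix.mul_inv_rev, Matrix.mulVec_mulVec, Matrix.mul_assoc,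
      Matrix.nonsing_inv_mul _ hu, Matrix.mul_one, Matrix.dotProduct_mulVec,
      Matrix.vecMul_mulVec, hSsym, Matrix.mul_nonsing_inv _ hu]
    rw [EuclideanSpace.real_norm_sq_eq]
    simp [dotProduct, sq]
  ext s hs
  have hmeas : Measurable (fun x : EuclideanSpace ℝ (Fin n) =>
      ENNReal.ofReal ((2 * Real.pi) ^ (-(n : ℝ) / 2) * R.det ^ (-(1 : ℝ) / 2) *
        Real.exp (-(1 / 2) *
          ((fun i => x i - μv i) ⬝ᵥ R⁻¹.mulVec (fun i => x i - μv i))))) := by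
    simp only [dotProduct, Matrix.mulVec]
    fun_prop
  rw [withDensity_apply _ hs, Measure.map_apply hTm hs, withDensity_apply _ (hTm hs)]
  conv_lhs => rw [hvol]
  rw [Measure.restrict_smul, lintegral_smul_measure, setLIntegral_map hs hmeas hTm, smul_eq_mul]
  simp_rw [hquad]
  rw [← lintegral_const_mul _ (by fun_prop)]
  refine lintegral_congr fun x => ?_
  rw [← ENNReal.ofReal_mul (abs_nonneg _), habs]
  congr 1
  have : R.det ^ ((1:ℝ) / 2) * R.det ^ (-(1:ℝ) / 2) = 1 := by
    rw [← Real.rpow_add hdetpos]; norm_num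
  linear_combination (2 * Real.pi) ^ (-(n : ℝ) / 2) * Real.exp (-(1 / 2) * ‖x‖ ^ 2) * this

end Dens

section Cost
open ProbabilityTheory Filter Topology

lemma aux_trace (n : ℕ) (μv : EuclideanSpace ℝ (Fin n))
    (R : Matrix (Fin n) (Fin n) ℝ) (hR : R.PosDef) :
    Integrable (fun x => ‖μv - x‖ ^ 2) (multivariateGaussian μv R) ∧
    ∫ x, ‖μv - x‖ ^ 2 ∂(multivariateGaussian μv R) = R.trace := by
  have hL : MemLp (fun x : EuclideanSpace ℝ (Fin n) => x) 2 (multivariateGaussian μv R) :=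
    IsGaussian.memLp_two_id
  have hi : ∀ i : Fin n, MemLp (fun x : EuclideanSpace ℝ (Fin n) => x i) 2
      (multivariateGaussian μv R) := fun i =>
    (EuclideanSpace.proj (𝕜 := ℝ) i : EuclideanSpace ℝ (Fin n) →L[ℝ] ℝ).comp_memLp' hL
  have hm : ∀ i : Fin n, ∫ x, x i ∂(multivariateGaussian μv R) = μv i := fun i => by
    have := (EuclideanSpace.proj (𝕜 := ℝ) i : EuclideanSpace ℝ (Fin n) →L[ℝ] ℝ).integral_comp_comm
      (hL.integrable (by norm_num))
    simpa using this
  constructor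
  · exact ((memLp_const μv).sub hL).integrable_norm_pow (by norm_num)
  · simp_rw [EuclideanSpace.real_norm_sq_eq]
    rw [integral_finsetSum]
    · rw [Matrix.trace]
      refine Finset.sum_congr rfl fun i _ => ?_
      rw [Matrix.diag_apply, ← variance_eval_multivariateGaussian (μ := μv) hR.posSemidef i,
        variance_eq_integral (hi i).aemeasurable, hm]
      refine integral_congr_ae (Eventually.of_forall fun x => ?_)
      simp only [PiLp.sub_apply]
      ring
    · intro i _
      have := ((memLp_const (μv i)).sub (hi i)).integrable_sq
      exact this

lemma aux_cost (n : ℕ) (μv : EuclideanSpace ℝ (Fin n))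
    (R : Matrix (Fin n) (Fin n) ℝ) (hR : R.PosDef) (c : EuclideanSpace ℝ (Fin n)) (σ : ℝ)
    (hσ : 0 < σ) (hc : σ ^ 2 = c.ofLp ⬝ᵥ R *ᵥ c.ofLp) :
    ∫ x, min (‖μv - x‖ ^ 2) (‖(μv + c) - x‖ ^ 2) ∂(multivariateGaussian μv R) =
      R.trace - 2 * σ * auxG (‖c‖ ^ 2 / (2 * σ)) := by
  obtain ⟨hI, htr⟩ := aux_trace n μv R hR
  have hL : MemLp (fun x : EuclideanSpace ℝ (Fin n) => x) 2 (multivariateGaussian μv R) :=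
    IsGaussian.memLp_two_id
  have hLi := hL.integrable (by norm_num)
  have hpt : ∀ x : EuclideanSpace ℝ (Fin n), min (‖μv - x‖ ^ 2) (‖(μv + c) - x‖ ^ 2) =
      ‖μv - x‖ ^ 2 - max 0 (2 * (inner ℝ c x - inner ℝ c μv) - ‖c‖ ^ 2) := by
    intro x
    have h : ‖(μv + c) - x‖ ^ 2 =
        ‖μv - x‖ ^ 2 - (2 * (inner ℝ c x - inner ℝ c μv) - ‖c‖ ^ 2) := by
      have h1 : (μv + c) - x = (μv - x) + c := by abel
      rw [h1, norm_add_sq_real, inner_sub_left, real_inner_comm x c, real_inner_comm μv c]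
      ring
    rw [h, ← min_sub_sub_left, sub_zero]
  simp_rw [hpt]
  have hIc : Integrable (fun x => inner ℝ c x) (multivariateGaussian μv R) :=
    (innerSL ℝ c).integrable_comp hLi
  rw [integral_sub hI, htr]
  swap
  · exact (integrable_const (0:ℝ)).sup
      (((hIc.sub (integrable_const _)).const_mul 2).sub (integrable_const _))
  congr 1
  have hlaw : (multivariateGaussian μv R).map (innerSL ℝ c) =
      (gaussianReal 0 1).map (fun z => inner ℝ c μv + σ * z) := by
    have h1 : (fun z : ℝ => inner ℝ c μv + σ * z) = (fun z => inner ℝ c μv + z) ∘ (fun z => σ * z) :=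
      rfl
    rw [IsGaussian.map_eq_gaussianReal, h1, ← Measure.map_map (by fun_prop) (by fun_prop),
      gaussianReal_map_const_mul, gaussianReal_map_const_add]
    congr 1
    · rw [(innerSL ℝ c).integral_comp_comm hLi]
      simp
    · have : Var[⇑(innerSL ℝ c); multivariateGaussian μv R] = σ ^ 2 := by
        rw [hc, ← covarianceBilin_multivariateGaussian (μ := μv) hR.posSemidef,
          covarianceBilin_self IsGaussian.memLp_two_id]
        rfl
      rw [this]
      ext
      simp [sq_nonneg]
  have h2 : ∫ x, max 0 (2 * (inner ℝ c x - inner ℝ c μv) - ‖c‖ ^ 2) ∂(multivariateGaussian μv R) =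
      ∫ y, max 0 (2 * (y - inner ℝ c μv) - ‖c‖ ^ 2)
        ∂((multivariateGaussian μv R).map (innerSL ℝ c)) := by
    rw [integral_map (by fun_prop) (by fun_prop)]
    rfl
  rw [h2, hlaw, integral_map (by fun_prop) (by fun_prop), ← aux_expect, ← integral_const_mul]
  refine integral_congr_ae (Eventually.of_forall fun z => ?_)
  simp only
  rw [mul_max_of_nonneg _ _ (by positivity : 0 ≤ 2 * σ), mul_zero]
  congr 1
  field_simp
  ring

end Cost

/-- **Optimal hierarchical estimator in the multivariate Gaussian case.**
Let `χ*` be the unique positive solution of `φ(χ) = 2χ(1 − Φ(χ))`. For a Gaussian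
measure `γ` on `ℝⁿ` with mean `μv` and positive definite covariance `R`, largest
eigenvalue `λ₁` with unit eigenvector `v`, the point `b* = μv + 2χ*√λ₁ v`
minimizes `b ↦ J(μv, b)`, with minimal value `trace R − 2χ*φ(χ*)λ₁`. -/
theorem gaussian_hierarchical_optimal
    (n : ℕ) (hn : 1 ≤ n)
    (μv : EuclideanSpace ℝ (Fin n))
    (R : Matrix (Fin n) (Fin n) ℝ) (hR : R.PosDef)
    (lam1 : ℝ) (v : EuclideanSpace ℝ (Fin n)) (hv : ‖v‖ = 1)
    (heig : R.mulVec (fun i => v i) = fun i => lam1 * v i)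
    (hmax : ∀ x : Fin n → ℝ, x ⬝ᵥ R.mulVec x ≤ lam1 * (x ⬝ᵥ x))
    (γ : Measure (EuclideanSpace ℝ (Fin n)))
    (hγ : γ = volume.withDensity (fun x =>
      ENNReal.ofReal ((2 * Real.pi) ^ (-(n : ℝ) / 2) * R.det ^ (-(1 : ℝ) / 2) *
        Real.exp (-(1 / 2) *
          ((fun i => x i - μv i) ⬝ᵥ R⁻¹.mulVec (fun i => x i - μv i))))))
    (χs : ℝ) (hχpos : 0 < χs)
    (hχeq : stdGaussianPDF χs = 2 * χs * (1 - stdGaussianCDF χs))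
    (hχuniq : ∀ χ : ℝ, 0 < χ →
      stdGaussianPDF χ = 2 * χ * (1 - stdGaussianCDF χ) → χ = χs) :
    (∀ b : EuclideanSpace ℝ (Fin n),
      ∫ x, min (‖μv - x‖ ^ 2)
              (‖(μv + (2 * χs * Real.sqrt lam1) • v) - x‖ ^ 2) ∂γ ≤
        ∫ x, min (‖μv - x‖ ^ 2) (‖b - x‖ ^ 2) ∂γ) ∧
    ∫ x, min (‖μv - x‖ ^ 2)
            (‖(μv + (2 * χs * Real.sqrt lam1) • v) - x‖ ^ 2) ∂γ =
      R.trace - 2 * χs * stdGaussianPDF χs * lam1 := by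
  rw [aux_density n μv R hR] at hγ
  subst hγ
  have hvv : v.ofLp ⬝ᵥ v.ofLp = 1 := by
    have := EuclideanSpace.real_norm_sq_eq v
    rw [hv] at this
    simp only [dotProduct]
    rw [one_pow] at this
    rw [this]
    exact Finset.sum_congr rfl fun i _ => (sq _).symm
  have hnorm : ∀ c : EuclideanSpace ℝ (Fin n), c.ofLp ⬝ᵥ c.ofLp = ‖c‖ ^ 2 := by
    intro c
    rw [EuclideanSpace.real_norm_sq_eq]
    simp only [dotProduct]
    exact Finset.sum_congr rfl fun i _ => (sq _).symm
  have hpd : ∀ c : EuclideanSpace ℝ (Fin n), c ≠ 0 → 0 < c.ofLp ⬝ᵥ R *ᵥ c.ofLp := by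
    intro c hc
    have h := hR.dotProduct_mulVec_pos (x := c.ofLp) (by simpa using hc)
    simpa using h
  have hRv : R *ᵥ v.ofLp = lam1 • v.ofLp := heig
  have hlam : 0 < lam1 := by
    have h := hpd v (by rintro rfl; simp at hv)
    rw [hRv, dotProduct_smul, hvv] at h
    simpa using h
  set s := Real.sqrt lam1 with hs
  have hs0 : 0 < s := Real.sqrt_pos.mpr hlam
  have hss : s ^ 2 = lam1 := Real.sq_sqrt hlam.le
  have hG : auxG χs = stdGaussianPDF χs / 2 := by unfold auxG; linarith
  have hval : ∫ x, min (‖μv - x‖ ^ 2) (‖(μv + (2 * χs * s) • v) - x‖ ^ 2)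
      ∂(ProbabilityTheory.multivariateGaussian μv R) =
      R.trace - 2 * χs * stdGaussianPDF χs * lam1 := by
    rw [aux_cost n μv R hR ((2 * χs * s) • v) (2 * χs * lam1) (by positivity)]
    · have h1 : ‖(2 * χs * s) • v‖ ^ 2 / (2 * (2 * χs * lam1)) = χs := by
        rw [norm_smul, hv, mul_one, Real.norm_eq_abs, sq_abs, mul_pow, hss]
        field_simp
        try norm_num
      rw [h1, hG]; ring
    · rw [WithLp.ofLp_smul, Matrix.mulVec_smul, hRv, smul_dotProduct, dotProduct_smul,
        dotProduct_smul, hvv]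
      simp only [smul_eq_mul]
      rw [← hss]; ring
  refine ⟨fun b => ?_, hval⟩
  rw [hval]
  have hφ := aux_pdf_pos χs
  by_cases hb : b = μv
  · subst hb
    simp only [min_self]
    rw [(aux_trace n b R hR).2]
    have : 0 ≤ 2 * χs * stdGaussianPDF χs * lam1 := by positivity
    linarith
  obtain ⟨c, rfl⟩ : ∃ c, b = μv + c := ⟨b - μv, by abel⟩
  have hc : c ≠ 0 := by rintro rfl; simp at hb
  have hcn : 0 < ‖c‖ := norm_pos_iff.mpr hc
  have hq := hpd c hc
  have hqle : c.ofLp ⬝ᵥ R *ᵥ c.ofLp ≤ (s * ‖c‖) ^ 2 := by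
    have := hmax c.ofLp
    rwa [hnorm, ← hss, ← mul_pow] at this
  set σ := Real.sqrt (c.ofLp ⬝ᵥ R *ᵥ c.ofLp) with hσ
  have hσ0 : 0 < σ := Real.sqrt_pos.mpr hq
  have hσ2 : σ ^ 2 = c.ofLp ⬝ᵥ R *ᵥ c.ofLp := Real.sq_sqrt hq.le
  rw [aux_cost n μv R hR c σ hσ0 hσ2]
  have hσle : σ ≤ s * ‖c‖ := by
    rw [hσ]; exact Real.sqrt_le_iff.mpr ⟨by positivity, hqle⟩
  have h1 : ‖c‖ / (2 * s) ≤ ‖c‖ ^ 2 / (2 * σ) := by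
    rw [div_le_div_iff₀ (by positivity) (by positivity)]
    nlinarith [mul_le_mul_of_nonneg_left hσle hcn.le]
  have h2 := auxG_anti h1
  have h3 := auxG_max χs hχpos hχeq hχuniq (‖c‖ / (2 * s)) (by positivity)
  have h4 : 2 * σ * auxG (‖c‖ ^ 2 / (2 * σ)) ≤ 2 * (s * ‖c‖) * auxG (‖c‖ / (2 * s)) := by
    apply mul_le_mul (by linarith) h2 (auxG_nonneg _) (by positivity)
  have h5 : 2 * (s * ‖c‖) * auxG (‖c‖ / (2 * s)) =
      4 * lam1 * (‖c‖ / (2 * s) * auxG (‖c‖ / (2 * s))) := by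
    rw [← hss]; field_simp; ring
  have h6 := mul_le_mul_of_nonneg_left h3 (by positivity : 0 ≤ 4 * lam1)
  rw [hG] at h6
  have h7 : 4 * lam1 * (χs * (stdGaussianPDF χs / 2)) = 2 * χs * stdGaussianPDF χs * lam1 := by ring
  linarith
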